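/- Let n ≥ 1 and d ≥ 1 be integers and let D ≥ 1 be a real number. Suppose f : ([4])^n → ℝ^d satisfies ‖f(x₁,…,xₙ)‖₁ ≤ 1 for all x₁,…,xₙ ∈ [4], and that for every ℓ ∈ [n] and every x₁,…,x_{ℓ−1} ∈ [4], one has (1/4)·‖ f̄(x₁,…,x_{ℓ−1},1) + f̄(x₁,…,x_{ℓ−1},3) − f̄(x₁,…,x_{ℓ−1},2) − f̄(x₁,…,x_{ℓ−1},4) ‖₁ ≥ 1/D, where f̄(x₁,…,x_ℓ) denotes the average of f(x₁,…,xₙ) over x_{ℓ+1},…,xₙ chosen uniformly and independently from [4]. Then d ≥ 2^{(1 − H(1/2 − 1/(2D)))·n − 1} − 1/2. -/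

import Mathlib

/-- The ℓ1 norm of a vector in ℝ^d: the sum of the absolute values of its coordinates. -/
def l1norm {d : ℕ} (v : Fin d → ℝ) : ℝ := ∑ j, |v j|

/-- The binary entropy function `H(δ) = −δ log₂ δ − (1−δ) log₂ (1−δ)`
(with the conventions `H(0) = 0` and `H(1/2) = 1`). -/
noncomputable def binH (p : ℝ) : ℝ :=
  -(p * Real.logb 2 p) - (1 - p) * Real.logb 2 (1 - p)

open Classical in
/-- For `f : [K]^n → ℝ^d` and a prefix `x = (x₁, …, x_ℓ)`, the average
`f̄(x₁,…,x_ℓ) = K^{−(n−ℓ)} · Σ_{x_{ℓ+1},…,x_n ∈ [K]} f(x₁,…,x_n)`,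
i.e. the average of `f` over all points whose first `ℓ` coordinates agree with `x`. -/
noncomputable def fbar {K n d : ℕ} (f : (Fin n → Fin K) → Fin d → ℝ)
    {ℓ : ℕ} (x : Fin ℓ → Fin K) : Fin d → ℝ :=
  ((K : ℝ) ^ (n - ℓ))⁻¹ •
    ∑ y : Fin n → Fin K,
      if ∀ i : Fin n, ∀ h : (i : ℕ) < ℓ, y i = x ⟨(i : ℕ), h⟩ then f y else 0

open Classical in
/-- The average of `f` over all points extending the prefix `x`, for values in any real module. -/
noncomputable def prefixAverage {E : Type*} [AddCommGroup E] [Module ℝ E] {K n : ℕ}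
    (f : (Fin n → Fin K) → E) {ℓ : ℕ} (x : Fin ℓ → Fin K) : E :=
  ((K : ℝ) ^ (n - ℓ))⁻¹ •
    ∑ y : Fin n → Fin K,
      if ∀ i : Fin n, ∀ h : (i : ℕ) < ℓ, y i = x ⟨(i : ℕ), h⟩ then f y else 0

section PrefixAverage

variable {E : Type*} [AddCommGroup E] [Module ℝ E] {K n : ℕ}

theorem fbar_eq_prefixAverage {d ℓ : ℕ} (f : (Fin n → Fin K) → Fin d → ℝ) (x : Fin ℓ → Fin K) :
    fbar f x = prefixAverage f x := rfl

theorem prefixAverage_map {E' : Type*} [AddCommGroup E'] [Module ℝ E'] (L : E →ₗ[ℝ] E')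
    (f : (Fin n → Fin K) → E) {ℓ : ℕ} (x : Fin ℓ → Fin K) :
    prefixAverage (fun y => L (f y)) x = L (prefixAverage f x) := by
  classical
  simp only [prefixAverage, map_smul, map_sum]
  congr 1
  refine Finset.sum_congr rfl fun y _ => ?_
  split_ifs <;> simp

theorem prefixAverage_full (f : (Fin n → Fin K) → E) (x : Fin n → Fin K) :
    prefixAverage f x = f x := by
  classical
  have h : ∀ y : Fin n → Fin K,
      (∀ i : Fin n, ∀ h : (i : ℕ) < n, y i = x ⟨(i : ℕ), h⟩) ↔ y = x := fun y =>
    ⟨fun h => funext fun i => h i i.2, fun h i _ => by rw [h]⟩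
  simp only [prefixAverage, h]
  simp

theorem extends_snoc_iff {ℓ : ℕ} (hℓ : ℓ < n) (x : Fin ℓ → Fin K) (b : Fin K)
    (y : Fin n → Fin K) :
    (∀ i : Fin n, ∀ h : (i : ℕ) < ℓ + 1,
        y i = (Fin.snoc x b : Fin (ℓ + 1) → Fin K) ⟨(i : ℕ), h⟩) ↔
      (∀ i : Fin n, ∀ h : (i : ℕ) < ℓ, y i = x ⟨(i : ℕ), h⟩) ∧ y ⟨ℓ, hℓ⟩ = b := by
  constructor
  · intro h
    refine ⟨fun i hi => ?_, ?_⟩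
    · rw [h i (by omega)]
      simp [Fin.snoc, hi]
    · rw [h ⟨ℓ, hℓ⟩ (by simp)]
      simp [Fin.snoc]
  · rintro ⟨h, hb⟩ i hi
    by_cases hi' : (i : ℕ) < ℓ
    · rw [h i hi']
      simp [Fin.snoc, hi']
    · have : i = ⟨ℓ, hℓ⟩ := Fin.ext (by simp; omega)
      subst this
      simp [Fin.snoc, hb]

theorem prefixAverage_snoc [NeZero K] {ℓ : ℕ} (hℓ : ℓ < n) (f : (Fin n → Fin K) → E)
    (x : Fin ℓ → Fin K) :
    prefixAverage f x =
      (K : ℝ)⁻¹ • ∑ b : Fin K, prefixAverage f (Fin.snoc x b : Fin (ℓ + 1) → Fin K) := by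
  classical
  simp only [prefixAverage, extends_snoc_iff hℓ]
  rw [← Finset.smul_sum, Finset.sum_comm, smul_smul, ← mul_inv, ← pow_succ',
    show n - (ℓ + 1) + 1 = n - ℓ by omega]
  congr 1
  refine Finset.sum_congr rfl fun y _ => ?_
  have sum_ite (P : Prop) :
      (if P then f y else 0) = ∑ b : Fin K, if P ∧ y ⟨ℓ, hℓ⟩ = b then f y else 0 := by
    by_cases h : P <;> simp [h]
  convert sum_ite _

theorem prefixAverage_snoc_four {ℓ : ℕ} (hℓ : ℓ < n) (f : (Fin n → Fin 4) → E)
    (x : Fin ℓ → Fin 4) :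
    prefixAverage f x =
      midpoint ℝ
        (midpoint ℝ (prefixAverage f (Fin.snoc x 0 : Fin (ℓ + 1) → Fin 4))
          (prefixAverage f (Fin.snoc x 2 : Fin (ℓ + 1) → Fin 4)))
        (midpoint ℝ (prefixAverage f (Fin.snoc x 1 : Fin (ℓ + 1) → Fin 4))
          (prefixAverage f (Fin.snoc x 3 : Fin (ℓ + 1) → Fin 4))) := by
  rw [prefixAverage_snoc hℓ, Fin.sum_univ_four]
  simp only [midpoint_eq_smul_add, invOf_eq_inv]
  push_cast
  module

end PrefixAverage

section Entropy

open Real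

variable {ι : Type*} [Fintype ι]

/-- The Shannon entropy, in nats, of a vector of probabilities. -/
noncomputable def shannonEntropy (v : ι → ℝ) : ℝ := ∑ i, negMulLog (v i)

theorem shannonEntropy_nonneg {v : ι → ℝ} (hv : v ∈ stdSimplex ℝ ι) : 0 ≤ shannonEntropy v :=
  Finset.sum_nonneg fun i _ => negMulLog_nonneg (hv.1 i)
    ((Finset.single_le_sum (fun j _ => hv.1 j) (Finset.mem_univ i)).trans_eq hv.2)

theorem shannonEntropy_le_log_card [Nonempty ι] {v : ι → ℝ} (hv : v ∈ stdSimplex ℝ ι) :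
    shannonEntropy v ≤ log (Fintype.card ι) := by
  have hN : (0 : ℝ) < Fintype.card ι := by exact_mod_cast Fintype.card_pos
  have h := concaveOn_negMulLog.le_map_sum (t := Finset.univ)
    (w := fun _ : ι => (Fintype.card ι : ℝ)⁻¹) (p := v) (fun _ _ => by positivity)
    (by simp [hN.ne']) (fun i _ => hv.1 i)
  simp only [smul_eq_mul, ← Finset.mul_sum, hv.2, mul_one] at h
  rw [negMulLog, log_inv, neg_mul_neg] at h
  exact le_of_mul_le_mul_left h (inv_pos.2 hN)

theorem average_shannonEntropy_le {p q : ι → ℝ} (hp : p ∈ stdSimplex ℝ ι)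
    (hq : q ∈ stdSimplex ℝ ι) :
    (shannonEntropy p + shannonEntropy q) / 2 ≤ shannonEntropy (midpoint ℝ p q) := by
  rw [shannonEntropy, shannonEntropy, shannonEntropy, ← Finset.sum_add_distrib, Finset.sum_div]
  refine Finset.sum_le_sum fun i _ => ?_
  have h := concaveOn_negMulLog.2 (hp.1 i) (hq.1 i) (by norm_num : (0 : ℝ) ≤ 1 / 2)
    (by norm_num : (0 : ℝ) ≤ 1 / 2) (by norm_num)
  simp only [smul_eq_mul] at h
  simp only [midpoint_eq_smul_add, invOf_eq_inv, Pi.smul_apply, Pi.add_apply, smul_eq_mul]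
  rw [show (2 : ℝ)⁻¹ * (p i + q i) = 1 / 2 * p i + 1 / 2 * q i by ring]
  linarith

theorem binEntropy_half_sub_abs (t : ℝ) :
    binEntropy (1 / 2 - |t|) = binEntropy (1 / 2 - t) := by
  rcases abs_choice t with h | h
  · rw [h]
  · rw [h, ← binEntropy_one_sub]
    congr 1
    ring

theorem average_negMulLog {p q : ℝ} (hp : 0 ≤ p) (hq : 0 ≤ q) :
    (negMulLog p + negMulLog q) / 2 =
      negMulLog ((p + q) / 2) - (p + q) / 2 * log 2 +
        (p + q) / 2 * binEntropy (1 / 2 - |p - q| / (2 * (p + q))) := by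
  rcases (add_nonneg hp hq).eq_or_lt with h | h
  · obtain rfl : p = 0 := by linarith
    obtain rfl : q = 0 := by linarith
    simp
  · set s := p + q with hs
    have habs : |p - q| / (2 * s) = |(q - p) / (2 * s)| := by
      rw [abs_div, abs_of_pos (by positivity : 0 < 2 * s), abs_sub_comm]
    have hr : 1 / 2 - (q - p) / (2 * s) = p / s := by
      rw [hs] at h ⊢
      field_simp
      ring
    have hr' : 1 - p / s = q / s := by
      rw [hs] at h ⊢
      field_simp
      ring
    rw [habs, binEntropy_half_sub_abs, hr, binEntropy_eq_negMulLog_add_negMulLog_one_sub, hr']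
    have h1 : negMulLog p = p / s * negMulLog s + s * negMulLog (p / s) := by
      rw [← negMulLog_mul, mul_div_cancel₀ _ h.ne']
    have h2 : negMulLog q = q / s * negMulLog s + s * negMulLog (q / s) := by
      rw [← negMulLog_mul, mul_div_cancel₀ _ h.ne']
    have h3 : negMulLog (s / 2) = negMulLog s / 2 + s / 2 * log 2 := by
      simp only [negMulLog, log_div h.ne' two_ne_zero]
      ring
    rw [h3, h1, h2, ← hr']
    ring

/-- The entropy gain under mixing two distributions, in terms of their total variation distance:
a form of Fano's inequality. -/
theorem average_shannonEntropy_add_le {p q : ι → ℝ} (hp : p ∈ stdSimplex ℝ ι)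
    (hq : q ∈ stdSimplex ℝ ι) {s : ℝ} (hs : 0 ≤ s) (hpq : s ≤ (∑ i, |p i - q i|) / 2) :
    (shannonEntropy p + shannonEntropy q) / 2 + (log 2 - binEntropy (1 / 2 - s / 2)) ≤
      shannonEntropy (midpoint ℝ p q) := by
  set m : ι → ℝ := fun i => (p i + q i) / 2
  set r : ι → ℝ := fun i => 1 / 2 - |p i - q i| / (2 * (p i + q i))
  have hm : ∑ i, m i = 1 := by
    simp only [m, ← Finset.sum_div, Finset.sum_add_distrib, hp.2, hq.2]
    norm_num
  have habs : ∀ i, |p i - q i| ≤ p i + q i := fun i =>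
    abs_le.2 ⟨by linarith [hp.1 i], by linarith [hq.1 i]⟩
  have hsum : (∑ i, |p i - q i|) / 2 ≤ 1 := by
    have := Finset.sum_le_sum fun i (_ : i ∈ Finset.univ) => habs i
    rw [Finset.sum_add_distrib, hp.2, hq.2] at this
    linarith
  have hr : ∀ i ∈ Finset.univ, r i ∈ Set.Icc (0 : ℝ) 1 := fun i _ => by
    have h0 : 0 ≤ p i + q i := add_nonneg (hp.1 i) (hq.1 i)
    have h1 : |p i - q i| / (2 * (p i + q i)) ≤ 1 / 2 :=
      div_le_of_le_mul₀ (by positivity) (by norm_num) (by linarith [habs i])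
    have h2 : 0 ≤ |p i - q i| / (2 * (p i + q i)) := by positivity
    simp only [r]
    constructor <;> linarith
  have hmr : ∑ i, m i * r i = 1 / 2 - (∑ i, |p i - q i|) / 2 / 2 := by
    have : ∀ i, m i * r i = m i / 2 - |p i - q i| / 2 / 2 := fun i => by
      rcases (add_nonneg (hp.1 i) (hq.1 i)).eq_or_lt with h | h
      · have := habs i
        rw [← h] at this
        have h0 : |p i - q i| = 0 := le_antisymm this (abs_nonneg _)
        simp [m, ← h, h0]
      · simp only [m, r]
        field_simp
    simp only [this, Finset.sum_sub_distrib, ← Finset.sum_div, hm]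
  have hjensen := strictConcave_binEntropy.concaveOn.le_map_sum (t := Finset.univ)
    (w := m) (p := r) (fun i _ => by have := hp.1 i; have := hq.1 i; simp only [m]; positivity)
    hm hr
  simp only [smul_eq_mul, hmr] at hjensen
  have hmono : binEntropy (1 / 2 - (∑ i, |p i - q i|) / 2 / 2) ≤ binEntropy (1 / 2 - s / 2) :=
    binEntropy_strictMonoOn.monotoneOn ⟨by linarith, by linarith⟩ ⟨by linarith, by linarith⟩
      (by linarith)
  have hsplit : (shannonEntropy p + shannonEntropy q) / 2 =
      shannonEntropy (midpoint ℝ p q) - log 2 + ∑ i, m i * binEntropy (r i) := by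
    have hlog : log 2 = ∑ i, m i * log 2 := by rw [← Finset.sum_mul, hm, one_mul]
    rw [hlog]
    simp only [shannonEntropy, ← Finset.sum_add_distrib, Finset.sum_div,
      ← Finset.sum_sub_distrib]
    refine Finset.sum_congr rfl fun i _ => ?_
    rw [average_negMulLog (hp.1 i) (hq.1 i)]
    simp only [midpoint_eq_smul_add, invOf_eq_inv, Pi.smul_apply, Pi.add_apply, smul_eq_mul, m, r,
      div_eq_inv_mul]
  linarith

theorem midpoint_mem_stdSimplex {p q : ι → ℝ} (hp : p ∈ stdSimplex ℝ ι)
    (hq : q ∈ stdSimplex ℝ ι) : midpoint ℝ p q ∈ stdSimplex ℝ ι :=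
  (convex_stdSimplex ℝ ι).midpoint_mem hp hq

/-- If revealing the parity of each further coordinate is always worth total variation `s`, the
averages over prefixes have entropy at least linear in the number of unrevealed coordinates. -/
theorem shannonEntropy_prefixAverage {n : ℕ} {g : (Fin n → Fin 4) → ι → ℝ}
    (hg : ∀ x, g x ∈ stdSimplex ℝ ι) {s : ℝ} (hs : 0 ≤ s)
    (hsep : ∀ ℓ : ℕ, ℓ < n → ∀ x : Fin ℓ → Fin 4,
      s ≤ (1 / 4 : ℝ) * ∑ i,
        |(prefixAverage g (Fin.snoc x 0 : Fin (ℓ + 1) → Fin 4)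
          + prefixAverage g (Fin.snoc x 2 : Fin (ℓ + 1) → Fin 4)
          - prefixAverage g (Fin.snoc x 1 : Fin (ℓ + 1) → Fin 4)
          - prefixAverage g (Fin.snoc x 3 : Fin (ℓ + 1) → Fin 4)) i|)
    (k : ℕ) {ℓ : ℕ} (hℓ : ℓ + k = n) (x : Fin ℓ → Fin 4) :
    prefixAverage g x ∈ stdSimplex ℝ ι ∧
      k * (log 2 - binEntropy (1 / 2 - s / 2)) ≤ shannonEntropy (prefixAverage g x) := by
  induction k generalizing ℓ with
  | zero =>
    obtain rfl : ℓ = n := by omega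
    rw [prefixAverage_full]
    exact ⟨hg x, by simpa using shannonEntropy_nonneg (hg x)⟩
  | succ k ih =>
    have hlt : ℓ < n := by omega
    rw [prefixAverage_snoc_four hlt]
    have hsep' := hsep ℓ hlt x
    obtain ⟨h0, e0⟩ := ih (by omega) (Fin.snoc x 0 : Fin (ℓ + 1) → Fin 4)
    obtain ⟨h1, e1⟩ := ih (by omega) (Fin.snoc x 1 : Fin (ℓ + 1) → Fin 4)
    obtain ⟨h2, e2⟩ := ih (by omega) (Fin.snoc x 2 : Fin (ℓ + 1) → Fin 4)
    obtain ⟨h3, e3⟩ := ih (by omega) (Fin.snoc x 3 : Fin (ℓ + 1) → Fin 4)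
    generalize prefixAverage g (Fin.snoc x 0 : Fin (ℓ + 1) → Fin 4) = v₀ at *
    generalize prefixAverage g (Fin.snoc x 1 : Fin (ℓ + 1) → Fin 4) = v₁ at *
    generalize prefixAverage g (Fin.snoc x 2 : Fin (ℓ + 1) → Fin 4) = v₂ at *
    generalize prefixAverage g (Fin.snoc x 3 : Fin (ℓ + 1) → Fin 4) = v₃ at *
    have h02 := midpoint_mem_stdSimplex h0 h2
    have h13 := midpoint_mem_stdSimplex h1 h3
    refine ⟨midpoint_mem_stdSimplex h02 h13, ?_⟩
    have hdist : s ≤ (∑ i, |midpoint ℝ v₀ v₂ i - midpoint ℝ v₁ v₃ i|) / 2 := by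
      refine hsep'.trans_eq ?_
      rw [Finset.mul_sum, Finset.sum_div]
      refine Finset.sum_congr rfl fun i _ => ?_
      have : midpoint ℝ v₀ v₂ i - midpoint ℝ v₁ v₃ i = (v₀ + v₂ - v₁ - v₃) i / 2 := by
        simp only [midpoint_eq_smul_add, invOf_eq_inv, Pi.smul_apply, Pi.add_apply, Pi.sub_apply,
          smul_eq_mul]
        ring
      rw [this, abs_div, abs_two]
      ring
    have hmix := average_shannonEntropy_add_le h02 h13 hs hdist
    have a02 := average_shannonEntropy_le h0 h2
    have a13 := average_shannonEntropy_le h1 h3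
    push_cast
    linarith

end Entropy

section SignSplitting

variable {d : ℕ}

/-- The positive parts, the negative parts and the slack of a vector of `ℓ1` norm at most `1`,
which together form a probability vector. -/
noncomputable def signSplit (v : Fin d → ℝ) : (Fin d ⊕ Fin d) ⊕ Unit → ℝ :=
  Sum.elim (Sum.elim (fun j => (v j)⁺) (fun j => (v j)⁻)) (fun _ => 1 - l1norm v)

/-- The left inverse of `signSplit`, subtracting negative parts from positive parts. -/
def signMerge (d : ℕ) : ((Fin d ⊕ Fin d) ⊕ Unit → ℝ) →ₗ[ℝ] Fin d → ℝ where
  toFun w j := w (Sum.inl (Sum.inl j)) - w (Sum.inl (Sum.inr j))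
  map_add' v w := by
    ext j
    simp only [Pi.add_apply]
    ring
  map_smul' c w := by
    ext j
    simp only [Pi.smul_apply, smul_eq_mul, RingHom.id_apply]
    ring

theorem signMerge_signSplit (v : Fin d → ℝ) : signMerge d (signSplit v) = v := by
  ext j
  simp [signMerge, signSplit]

theorem signSplit_mem_stdSimplex {v : Fin d → ℝ} (hv : l1norm v ≤ 1) :
    signSplit v ∈ stdSimplex ℝ ((Fin d ⊕ Fin d) ⊕ Unit) := by
  constructor
  · rintro ((j | j) | j)
    · exact posPart_nonneg (v j)
    · exact negPart_nonneg (v j)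
    · exact sub_nonneg.2 hv
  · simp [signSplit, l1norm, ← Finset.sum_add_distrib, posPart_add_negPart]

theorem l1norm_signMerge_le (w : (Fin d ⊕ Fin d) ⊕ Unit → ℝ) :
    l1norm (signMerge d w) ≤ ∑ i, |w i| := by
  rw [Fintype.sum_sum_type, Fintype.sum_sum_type, ← Finset.sum_add_distrib]
  exact (Finset.sum_le_sum fun j _ => abs_sub _ _).trans
    (le_add_of_nonneg_right (Finset.sum_nonneg fun _ _ => abs_nonneg _))

end SignSplitting

theorem binH_eq_binEntropy_div (p : ℝ) : binH p = Real.binEntropy p / Real.log 2 := by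
  simp only [binH, Real.logb, Real.binEntropy_eq_negMulLog_add_negMulLog_one_sub, Real.negMulLog]
  ring

/-- The case `k = 2` of the main technical theorem: if `f : [4]^n → ℝ^d` has
`‖f(x)‖₁ ≤ 1` everywhere and satisfies, for every `ℓ ∈ [n]` and every prefix
`x₁,…,x_{ℓ−1} ∈ [4]`,
`(1/4)·‖ f̄(x…,1) + f̄(x…,3) − f̄(x…,2) − f̄(x…,4) ‖₁ ≥ 1/D`,
then `d ≥ 2^{(1 − H(1/2 − 1/(2D)))n − 1} − 1/2`. Here elements of `[4] = {1,2,3,4}`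
are represented by `Fin 4 = {0,1,2,3}` (so value `b` corresponds to index `b−1`),
and the prefix of length `ℓ−1` is quantified as a prefix of length `ℓ < n`. -/
theorem main_theorem_k_two (n d : ℕ) (hn : 1 ≤ n) (hd : 1 ≤ d) (D : ℝ) (hD : 1 ≤ D)
    (f : (Fin n → Fin 4) → Fin d → ℝ)
    (hnorm : ∀ x, l1norm (f x) ≤ 1)
    (hconstr : ∀ ℓ : ℕ, ℓ < n → ∀ x : Fin ℓ → Fin 4,
      1 / D ≤ (1 / 4 : ℝ) * l1norm
        (fbar f (Fin.snoc x (0 : Fin 4)) + fbar f (Fin.snoc x (2 : Fin 4))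
          - fbar f (Fin.snoc x (1 : Fin 4)) - fbar f (Fin.snoc x (3 : Fin 4)))) :
    (2 : ℝ) ^ ((1 - binH (1 / 2 - 1 / (2 * D))) * n - 1) - 1 / 2 ≤ (d : ℝ) := by
  set g : (Fin n → Fin 4) → (Fin d ⊕ Fin d) ⊕ Unit → ℝ := fun x => signSplit (f x)
  have hfbar : ∀ {ℓ : ℕ} (x : Fin ℓ → Fin 4), fbar f x = signMerge d (prefixAverage g x) := by
    intro ℓ x
    rw [fbar_eq_prefixAverage, ← prefixAverage_map]
    simp only [g, signMerge_signSplit]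
  have hsep := fun ℓ hℓ x => (hconstr ℓ hℓ x).trans (by
    simp only [hfbar, ← map_add, ← map_sub]
    exact mul_le_mul_of_nonneg_left (l1norm_signMerge_le _) (by norm_num))
  obtain ⟨hmem, hent⟩ := shannonEntropy_prefixAverage
    (fun x => signSplit_mem_stdSimplex (hnorm x)) (by positivity) hsep n (zero_add n) Fin.elim0
  have hlog := hent.trans (shannonEntropy_le_log_card hmem)
  have hcard : ((Fintype.card ((Fin d ⊕ Fin d) ⊕ Unit) : ℕ) : ℝ) = 2 * d + 1 := by
    simp
    ring
  have hl2 : 0 < Real.log 2 := Real.log_pos one_lt_two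
  have hexp : (1 - binH (1 / 2 - 1 / (2 * D))) * n * Real.log 2 ≤ Real.log (2 * d + 1) := by
    rw [hcard] at hlog
    refine le_trans (le_of_eq ?_) hlog
    rw [binH_eq_binEntropy_div, show 1 / D / 2 = 1 / (2 * D) by rw [div_div, mul_comm]]
    field_simp
  have hpow : (2 : ℝ) ^ ((1 - binH (1 / 2 - 1 / (2 * D))) * n) ≤ 2 * d + 1 := by
    rw [← Real.le_logb_iff_rpow_le one_lt_two (by positivity), Real.logb, le_div_iff₀ hl2]
    exact hexp
  rw [Real.rpow_sub_one two_ne_zero]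
  linarith
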